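/- Let K be a field of characteristic 0 and let a, b, c ∈ K be algebraically independent over ℚ, and let d = (1 - a·c)/b (so a·c + b·d = 1). If an element x ∈ K is algebraic over the subfield ℚ(a, b) and also algebraic over the subfield ℚ(c, d), then x is algebraic over ℚ. -/

import Mathlib

open AlgebraicIndependent Polynomial in
theorem aux_mem_closure {A : Type*} [CommRing A] [IsDomain A] [Algebra ℚ A] {s : Set A} {y : A} :
    y ∈ (matroid ℚ A).closure s ↔ IsAlgebraic (Algebra.adjoin ℚ s) y := by
  rw [matroid_closure_eq]; rfl

open AlgebraicIndependent Polynomial in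
theorem aux_transfer {A B : Type*} [CommRing A] [IsDomain A] [Algebra ℚ A]
    [CommRing B] [IsDomain B] [Algebra ℚ B] (f : A →ₐ[ℚ] B) (hf : Function.Injective f)
    {s : Set A} {y : A} :
    f y ∈ (matroid ℚ B).closure (f '' s) ↔ y ∈ (matroid ℚ A).closure s := by
  rw [aux_mem_closure, aux_mem_closure, Algebra.adjoin_image]
  exact isAlgebraic_ringHom_iff_of_comp_eq
    (Subalgebra.equivMapOfInjective (Algebra.adjoin ℚ s) f hf) f hf rfl

open AlgebraicIndependent Polynomial in
theorem aux_div {A : Type*} [CommRing A] [IsDomain A] [Algebra ℚ A] (S : Subalgebra ℚ A)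
    (hS : ∀ a : A, IsAlgebraic S a → a ∈ S) {u v w : A} (hu : u ∈ S) (hw : w ∈ S)
    (hu0 : u ≠ 0) (h : u * v = w) : v ∈ S := by
  apply hS
  refine ⟨C (⟨u, hu⟩ : S) * X - C (⟨w, hw⟩ : S), ?_, ?_⟩
  · intro h0
    have := congrArg (fun p => (p.coeff 1 : S)) h0
    simp [coeff_C] at this
    exact hu0 (congrArg Subtype.val this)
  · simp only [map_sub, map_mul, aeval_C, aeval_X]
    change u * v - w = 0
    rw [h, sub_self]

open AlgebraicIndependent in
theorem aux_flat {A : Type*} [CommRing A] [IsDomain A] [Algebra ℚ A] (s : Set A) :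
    ∃ S : Subalgebra ℚ A, (S : Set A) = (matroid ℚ A).closure s ∧
      ∀ a : A, IsAlgebraic S a → a ∈ S := by
  obtain ⟨S, h1, h2⟩ := matroid_isFlat_iff.1 ((matroid ℚ A).isFlat_closure s)
  exact ⟨S, h1, fun a ha => by rw [← SetLike.mem_coe, h1]; exact h2 a ha⟩

open AlgebraicIndependent in
open scoped IntermediateField.algebraAdjoinAdjoin in
theorem aux_subfield {K : Type*} [Field K] [CharZero K] (s : Set K) (x : K)
    (h : IsAlgebraic (Subfield.closure s) x) : x ∈ (matroid ℚ K).closure s := by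
  rw [aux_mem_closure, IsFractionRing.isAlgebraic_iff _ (IntermediateField.adjoin ℚ s) K]
  have hle : Subfield.closure s ≤ (IntermediateField.adjoin ℚ s).toSubfield :=
    Subfield.closure_le.2 (IntermediateField.subset_adjoin ℚ s)
  exact h.ringHom_of_comp_eq (S := IntermediateField.adjoin ℚ s)
    (Subfield.inclusion hle) (RingHom.id K) (RingHom.injective _) rfl

open AlgebraicIndependent Polynomial in
/-- Fact 3.5 (acl(a,b) ∩ acl(c,d) = acl(∅)): if `a, b, c` are algebraically independent
over `ℚ` in a field of characteristic `0` and `d = (1 - a·c)/b`, then any `x` algebraic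
over `ℚ(a, b)` and over `ℚ(c, d)` is algebraic over `ℚ`. -/
theorem algebraic_over_both_sides_implies_algebraic {K : Type*} [Field K] [CharZero K]
    (a b c : K) (hind : AlgebraicIndependent ℚ ![a, b, c])
    (d : K) (hd : d = (1 - a * c) / b)
    (x : K)
    (hx1 : IsAlgebraic (Subfield.closure ({a, b} : Set K)) x)
    (hx2 : IsAlgebraic (Subfield.closure ({c, d} : Set K)) x) :
    IsAlgebraic ℚ x := by
  have h1 := aux_subfield _ _ hx1
  have h2 := aux_subfield _ _ hx2
  have hb : b ≠ 0 := hind.ne_zero 1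
  have hcab : c ∉ (matroid ℚ K).closure {a, b} := by
    rw [aux_mem_closure]
    have := hind.transcendental_adjoin (s := {0, 1}) (i := 2) (by simp)
    rw [Set.image_pair] at this
    exact this
  obtain ⟨S, hSc, hS⟩ := aux_flat ({a, b} : Set K)
  have hsub : ({a, b} : Set K) ⊆ S := by
    rw [hSc]; exact (matroid ℚ K).subset_closure _ (by simp)
  have haS : a ∈ S := hsub (by simp)
  have hbS : b ∈ S := hsub (by simp)
  have hbiS : b⁻¹ ∈ S := aux_div S hS hbS S.one_mem hb (mul_inv_cancel₀ hb)
  have hxS : x ∈ S := by rw [← SetLike.mem_coe, hSc]; exact h1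
  have hcS : Transcendental S c := fun h => hcab (by rw [← hSc]; exact hS c h)
  let φ : S[X] →ₐ[ℚ] K := (aeval (R := S) c).restrictScalars ℚ
  have hφ : Function.Injective φ := transcendental_iff_injective.1 hcS
  let ψ : S[X] →ₐ[ℚ] K[X] := mapAlgHom S.val
  have hψ : Function.Injective ψ := map_injective _ Subtype.val_injective
  let δ : S[X] := C ⟨b⁻¹, hbiS⟩ * (1 - C ⟨a, haS⟩ * X)
  have hφδ : φ δ = d := by
    simp only [φ, δ, AlgHom.restrictScalars_apply, map_mul, map_sub, map_one, aeval_C, aeval_X]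
    change b⁻¹ * (1 - a * c) = d
    rw [hd]; field_simp
  have hφX : φ X = c := by simp [φ]
  have hφx : φ (C ⟨x, hxS⟩) = x := by
    simp only [φ, AlgHom.restrictScalars_apply, aeval_C]; rfl
  have : FaithfulSMul ℚ S[X] :=
    (faithfulSMul_iff_algebraMap_injective ℚ S[X]).2 (algebraMap ℚ S[X]).injective
  have h3 : (C ⟨x, hxS⟩ : S[X]) ∈ (matroid ℚ S[X]).closure {X, δ} := by
    rw [← aux_transfer φ hφ, hφx, Set.image_pair, hφX, hφδ]; exact h2
  set d' : K[X] := C b⁻¹ * (1 - C a * X) with hd'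
  have h4 : C x ∈ (matroid ℚ K[X]).closure {X, d'} := by
    rw [← aux_transfer ψ hψ, Set.image_pair] at h3
    simpa [ψ, δ, d'] using h3
  let κ : K →ₐ[ℚ] K[X] := (CAlgHom (R := K) (A := K)).restrictScalars ℚ
  have hκ : Function.Injective κ := C_injective
  have h5 : C x ∈ (matroid ℚ K[X]).closure {C c, C d} := by
    have := (aux_transfer κ hκ).2 h2
    rwa [Set.image_pair] at this
  set N := matroid ℚ K[X]
  -- rank four
  have hI : AlgebraicIndependent ℚ (Sum.elim (fun _ : Unit => (X : K[X]))
      (algebraMap K K[X] ∘ ![a, b, c])) :=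
    sumElim_comp hind (by
      rw [algebraicIndependent_unique_type_iff]; exact transcendental_X K)
  have hNI : N.Indep (Set.range (Sum.elim (fun _ : Unit => (X : K[X]))
      (algebraMap K K[X] ∘ ![a, b, c]))) := hI.to_subtype_range
  have hcard : N.eRk (Set.range (Sum.elim (fun _ : Unit => (X : K[X]))
      (algebraMap K K[X] ∘ ![a, b, c]))) = 4 := by
    rw [hNI.eRk_eq_encard, ← Set.image_univ, hI.injective.encard_image]
    simp [Set.encard_univ]
  obtain ⟨T, hTc, hT⟩ := aux_flat ({X, d'} ∪ {C c, C d} : Set K[X])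
  have hTs : ({X, d'} ∪ {C c, C d} : Set K[X]) ⊆ T := by
    rw [hTc]; exact N.subset_closure _ (by simp [N])
  have hX : X ∈ T := hTs (by simp)
  have hdT' : d' ∈ T := hTs (by simp)
  have hcT : C c ∈ T := hTs (by simp)
  have hdT : C d ∈ T := hTs (by simp)
  have hbb : (C b⁻¹ : K[X]) * C b = 1 := by rw [← C_mul, inv_mul_cancel₀ hb, C_1]
  have hdd : C d = C b⁻¹ * (1 - C a * C c) := by
    rw [hd, div_eq_inv_mul]; simp
  have hXc : (C c - X : K[X]) ≠ 0 := by
    intro h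
    have := congrArg (fun p => p.coeff 1) h
    simp [coeff_C] at this
  have hbi0 : (C b⁻¹ : K[X]) ≠ 0 := by simpa using hb
  have hdet : C c * d' - X * C d = C b⁻¹ * (C c - X) := by rw [hdd, hd']; ring
  have haT : C a ∈ T := aux_div T hT (u := C c * d' - X * C d) (w := d' - C d)
    (T.sub_mem (T.mul_mem hcT hdT') (T.mul_mem hX hdT)) (T.sub_mem hdT' hdT)
    (by rw [hdet]; exact mul_ne_zero hbi0 hXc) (by rw [hdet, hdd, hd']; ring)
  have hd0 : d' ≠ 0 := by
    intro h
    have := congrArg (fun p => p.coeff 0) h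
    simp [hd', hb] at this
  have hbT : C b ∈ T := aux_div T hT (u := d') (w := 1 - C a * X)
    hdT' (T.sub_mem T.one_mem (T.mul_mem haT hX)) hd0
    (by rw [hd']; linear_combination (1 - C a * X) * hbb)
  have hsubT : Set.range (Sum.elim (fun _ : Unit => (X : K[X]))
      (algebraMap K K[X] ∘ ![a, b, c])) ⊆ N.closure ({X, d'} ∪ {C c, C d}) := by
    rw [← hTc]
    rintro _ ⟨i | i, rfl⟩
    · exact hX
    · fin_cases i
      exacts [haT, hbT, hcT]
  have hrk : 4 ≤ N.eRk (N.closure {X, d'} ∪ N.closure {C c, C d}) := by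
    rw [← hcard]
    refine (N.eRk_mono hsubT).trans ?_
    rw [N.eRk_closure_eq]
    exact N.eRk_mono (Set.union_subset_union (N.subset_closure _ (by simp [N]))
      (N.subset_closure _ (by simp [N])))
  have hsm := N.eRk_inter_add_eRk_union_le (N.closure {X, d'}) (N.closure {C c, C d})
  rw [N.eRk_closure_eq, N.eRk_closure_eq] at hsm
  have e1 : N.eRk {X, d'} ≤ 2 := (N.eRk_le_encard _).trans ((Set.encard_insert_le _ _).trans (by rw [Set.encard_singleton]; norm_num))
  have e2 : N.eRk {C c, C d} ≤ 2 := (N.eRk_le_encard _).trans ((Set.encard_insert_le _ _).trans (by rw [Set.encard_singleton]; norm_num))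
  have hz : N.eRk (N.closure {X, d'} ∩ N.closure {C c, C d}) = 0 := by
    have h6 : N.eRk (N.closure {X, d'} ∩ N.closure {C c, C d}) + 4 ≤ 0 + 4 := by
      calc _ ≤ _ := add_le_add_right hrk _
        _ ≤ _ := hsm
        _ ≤ 2 + 2 := add_le_add e1 e2
        _ = 0 + 4 := by norm_num
    exact nonpos_iff_eq_zero.1 ((ENat.add_le_add_iff_right (by norm_num)).1 h6)
  rw [Matroid.eRk_eq_zero_iff (hX := by simp [N])] at hz
  have h7 : κ x ∈ N.closure (κ '' ∅) := by
    rw [Set.image_empty]; exact hz ⟨h4, h5⟩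
  rw [aux_transfer κ hκ, aux_mem_closure, Algebra.adjoin_empty] at h7
  exact (Subalgebra.isAlgebraic_bot_iff (algebraMap ℚ K).injective).1 h7
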